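/- Fix j : Fin T and let h be any real-valued function of trajectories that is measurable with respect to the history up to and including state s_j but excluding action a_j; precisely, h τ = h τ' whenever σ_τ i = σ_{τ'} i for all i ≤ j and α_τ i = α_{τ'} i for all i < j. Then for every θ, ∑_τ P θ τ * score θ j τ * h τ = 0; that is, the policy score at time j is uncorrelated under the trajectory distribution with any function of the past history and the current state (the conditional zero-mean property of the score underlying the causality argument). -/

import Mathlib

open scoped BigOperators

/-- The probability of a full trajectory `τ = (σ, α)` in a finite-horizon MDP:
`P θ τ = init (σ 0) * ∏ i π θ (σ i) (α i) * ∏_{i+1 < T} trans (σ i) (α i) (σ (i+1))`. -/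
noncomputable def Ptraj {S A : Type} [Fintype S] [Fintype A] {T : ℕ} (hT : 1 ≤ T)
    (init : S → ℝ) (trans : S → A → S → ℝ) (π : ℝ → S → A → ℝ)
    (θ : ℝ) (τ : (Fin T → S) × (Fin T → A)) : ℝ :=
  init (τ.1 ⟨0, hT⟩) * (∏ i : Fin T, π θ (τ.1 i) (τ.2 i)) *
    ∏ i : Fin T,
      if h : (i : ℕ) + 1 < T then trans (τ.1 i) (τ.2 i) (τ.1 ⟨(i : ℕ) + 1, h⟩) else 1

/-- The policy score at time `j` along trajectory `τ`. -/
noncomputable def score {S A : Type} {T : ℕ} (π : ℝ → S → A → ℝ)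
    (θ : ℝ) (j : Fin T) (τ : (Fin T → S) × (Fin T → A)) : ℝ :=
  deriv (fun u => Real.log (π u (τ.1 j) (τ.2 j))) θ

open Finset in
/-- Summing over all functions after resampling one coordinate multiplies the sum by the number of
values of that coordinate. -/
theorem sum_sum_update {ι X : Type*} [Fintype ι] [DecidableEq ι] [Fintype X]
    (k : ι) (F : (ι → X) → ℝ) :
    ∑ x : ι → X, ∑ v, F (Function.update x k v) = Fintype.card X * ∑ x, F x := by
  classical
  have key : ∑ p : (ι → X) × X, F (Function.update p.1 k p.2) = ∑ p : (ι → X) × X, F p.1 := by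
    refine Fintype.sum_equiv
      (Function.Involutive.toPerm (fun p : (ι → X) × X => (Function.update p.1 k p.2, p.1 k)) ?_)
      _ _ (fun p => rfl)
    rintro ⟨x, v⟩
    simp
  rw [Fintype.sum_prod_type, Fintype.sum_prod_type] at key
  rw [key]
  simp [Finset.mul_sum]

open Finset in
/-- A product of causal factors sums to zero over all paths as soon as the factor at time `j` sums
to zero, and all later factors sum to one, over the current coordinate. -/
theorem sum_prod_causal_eq_zero {X : Type*} [Fintype X] [Nonempty X] {T : ℕ}
    (g : Fin T → (Fin T → X) → ℝ)
    (hg : ∀ i x y, (∀ l ≤ i, x l = y l) → g i x = g i y) (j : Fin T)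
    (hj : ∀ x, ∑ v, g j (Function.update x j v) = 0)
    (hlater : ∀ i, j < i → ∀ x, ∑ v, g i (Function.update x i v) = 1) :
    ∑ x, ∏ i, g i x = 0 := by
  have hcard : (Fintype.card X : ℝ) ≠ 0 := by exact_mod_cast Fintype.card_ne_zero
  have factor : ∀ (k : Fin T) (x : Fin T → X),
      ∑ v, ∏ i ∈ Iic k, g i (Function.update x k v) =
        (∑ v, g k (Function.update x k v)) * ∏ i ∈ Iio k, g i x := by
    intro k x
    rw [Finset.sum_mul]
    refine Finset.sum_congr rfl fun v _ => ?_
    rw [← Finset.Iio_insert, Finset.prod_insert (by simp)]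
    congr 1
    refine Finset.prod_congr rfl fun i hi => hg _ _ _ fun l hl => ?_
    exact Function.update_of_ne (hl.trans_lt (Finset.mem_Iio.1 hi)).ne _ _
  have resample : ∀ k : Fin T, Fintype.card X * ∑ x, ∏ i ∈ Iic k, g i x =
      ∑ x, (∑ v, g k (Function.update x k v)) * ∏ i ∈ Iio k, g i x := by
    intro k
    rw [← sum_sum_update k (fun x => ∏ i ∈ Iic k, g i x)]
    exact Finset.sum_congr rfl fun x _ => factor k x
  have main : ∀ m : ℕ, ∀ hm : m < T, (j : ℕ) ≤ m →
      ∑ x, ∏ i ∈ Iic (⟨m, hm⟩ : Fin T), g i x = 0 := by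
    intro m hm hjm
    induction m, hjm using Nat.le_induction with
    | base =>
      have := resample j
      simpa [hj, hcard] using this
    | succ m hjm ih =>
      have hres := resample ⟨m + 1, hm⟩
      have hIio : Iio (⟨m + 1, hm⟩ : Fin T) = Iic ⟨m, by omega⟩ := by
        ext i
        simp [Fin.lt_def, Fin.le_def]
      simp only [hlater ⟨m + 1, hm⟩ (Fin.lt_def.2 (Nat.lt_succ_of_le hjm)), one_mul, hIio,
        ih (by omega)] at hres
      exact (mul_eq_zero.1 hres).resolve_left hcard
  have hlast := main (T - 1) (by have := j.2; omega) (by have := j.2; omega)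
  have huniv : Iic (⟨T - 1, by have := j.2; omega⟩ : Fin T) = univ := by
    ext i
    have := i.2
    simp only [Finset.mem_Iic, Fin.le_def, Finset.mem_univ, iff_true]
    omega
  rwa [huniv] at hlast

/-- The probability of entering the state at time `i`: the initial distribution at time zero, and
the transition probability from the previous state and action afterwards. -/
def entryProb {S A : Type} {n : ℕ} (init : S → ℝ) (trans : S → A → S → ℝ)
    (i : Fin (n + 1)) (x : Fin (n + 1) → S × A) : ℝ :=
  Fin.cases (motive := fun _ => ℝ) (init (x 0).1)
    (fun l => trans (x l.castSucc).1 (x l.castSucc).2 (x l.succ).1) i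

theorem Ptraj_eq_prod {S A : Type} [Fintype S] [Fintype A] {n : ℕ} (hT : 1 ≤ n + 1)
    (init : S → ℝ) (trans : S → A → S → ℝ) (π : ℝ → S → A → ℝ) (θ : ℝ)
    (x : Fin (n + 1) → S × A) :
    Ptraj hT init trans π θ (fun i => (x i).1, fun i => (x i).2) =
      ∏ i, (entryProb init trans i x * π θ (x i).1 (x i).2) := by
  have hentry : ∏ i, entryProb init trans i x =
      init (x 0).1 * ∏ l : Fin n, trans (x l.castSucc).1 (x l.castSucc).2 (x l.succ).1 := by
    rw [Fin.prod_univ_succ]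
    rfl
  have htrans : (∏ i : Fin (n + 1),
      if h : (i : ℕ) + 1 < n + 1 then trans (x i).1 (x i).2 (x ⟨(i : ℕ) + 1, h⟩).1 else 1) =
      ∏ l : Fin n, trans (x l.castSucc).1 (x l.castSucc).2 (x l.succ).1 := by
    rw [Fin.prod_univ_castSucc]
    simp [Fin.succ]
  rw [Finset.prod_mul_distrib, hentry, ← htrans]
  simp only [Ptraj]
  rw [mul_right_comm]
  rfl

theorem entryProb_congr {S A : Type} {n : ℕ} (init : S → ℝ) (trans : S → A → S → ℝ)
    (i : Fin (n + 1)) (x y : Fin (n + 1) → S × A) (hlt : ∀ l < i, x l = y l)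
    (hi : (x i).1 = (y i).1) :
    entryProb init trans i x = entryProb init trans i y := by
  cases i using Fin.cases with
  | zero => simp [entryProb, hi]
  | succ l => simp [entryProb, hi, hlt l.castSucc Fin.castSucc_lt_succ]

theorem sum_entryProb_update {S A : Type} [Fintype S] {n : ℕ} (init : S → ℝ)
    (trans : S → A → S → ℝ) (htrans_sum : ∀ s a, ∑ s', trans s a s' = 1)
    (i : Fin (n + 1)) (hi : 0 < i) (x : Fin (n + 1) → S × A) (a : A) :
    ∑ s, entryProb init trans i (Function.update x i (s, a)) = 1 := by
  cases i using Fin.cases with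
  | zero => exact absurd hi (lt_irrefl _)
  | succ l => simp [entryProb, Function.update_of_ne Fin.castSucc_lt_succ.ne, htrans_sum]

/-- The score function identity: the score has mean zero under the policy. -/
theorem sum_mul_deriv_log_eq_zero {A : Type*} [Fintype A] (p : ℝ → A → ℝ)
    (hpos : ∀ θ a, 0 < p θ a) (hsum : ∀ θ, ∑ a, p θ a = 1)
    (hdiff : ∀ a, Differentiable ℝ (fun θ => p θ a)) (θ : ℝ) :
    ∑ a, p θ a * deriv (fun u => Real.log (p u a)) θ = 0 := by
  have hlog : ∀ a, p θ a * deriv (fun u => Real.log (p u a)) θ = deriv (fun u => p u a) θ := by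
    intro a
    rw [deriv.log (hdiff a θ) (hpos θ a).ne', mul_div_cancel₀ _ (hpos θ a).ne']
  simp only [hlog]
  rw [← deriv_fun_sum fun a _ => hdiff a θ]
  simp [hsum]

/-- The conditional zero-mean property of the score underlying the causality
argument: the policy score at time `j` is uncorrelated, under the trajectory
distribution, with any function `h` of the history up to and including the
state at time `j` but excluding the action at time `j`. -/
theorem score_uncorrelated_with_history
    {S A : Type} [Fintype S] [Fintype A] [Nonempty S] [Nonempty A]
    {T : ℕ} (hT : 1 ≤ T)
    (init : S → ℝ) (hinit_nonneg : ∀ s, 0 ≤ init s) (hinit_sum : ∑ s, init s = 1)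
    (trans : S → A → S → ℝ) (htrans_nonneg : ∀ s a s', 0 ≤ trans s a s')
    (htrans_sum : ∀ s a, ∑ s', trans s a s' = 1)
    (π : ℝ → S → A → ℝ)
    (hπ_pos : ∀ θ s a, 0 < π θ s a)
    (hπ_sum : ∀ θ s, ∑ a, π θ s a = 1)
    (hπ_diff : ∀ s a, Differentiable ℝ (fun θ => π θ s a))
    (j : Fin T)
    (h : ((Fin T → S) × (Fin T → A)) → ℝ)
    (hhist : ∀ τ τ' : (Fin T → S) × (Fin T → A),
      (∀ i : Fin T, i ≤ j → τ.1 i = τ'.1 i) →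
      (∀ i : Fin T, i < j → τ.2 i = τ'.2 i) →
      h τ = h τ')
    (θ : ℝ) :
    ∑ τ : (Fin T → S) × (Fin T → A),
        Ptraj hT init trans π θ τ * score π θ j τ * h τ = 0 := by
  obtain ⟨n, rfl⟩ : ∃ n, T = n + 1 := ⟨T - 1, by omega⟩
  let path : (Fin (n + 1) → S × A) → (Fin (n + 1) → S) × (Fin (n + 1) → A) :=
    fun x => (fun i => (x i).1, fun i => (x i).2)
  let g : Fin (n + 1) → (Fin (n + 1) → S × A) → ℝ := fun i x =>
    entryProb init trans i x * π θ (x i).1 (x i).2 *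
      if i = j then score π θ j (path x) * h (path x) else 1
  have hprod : ∀ x, ∏ i, g i x =
      Ptraj hT init trans π θ (path x) * score π θ j (path x) * h (path x) := by
    intro x
    simp only [g, path]
    rw [Finset.prod_mul_distrib, ← Ptraj_eq_prod hT, Finset.prod_ite_eq' Finset.univ j]
    simp [mul_assoc]
  rw [← Fintype.sum_equiv (Equiv.arrowProdEquivProdArrow (Fin (n + 1)) (fun _ => S) (fun _ => A))
    (fun x => ∏ i, g i x) _ hprod]
  apply sum_prod_causal_eq_zero g _ j
  · intro x
    obtain ⟨a₀⟩ := ‹Nonempty A›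
    rw [Fintype.sum_prod_type]
    refine Finset.sum_eq_zero fun s _ => ?_
    have hterm : ∀ a, g j (Function.update x j (s, a)) =
        entryProb init trans j (Function.update x j (s, a₀)) *
          h (path (Function.update x j (s, a₀))) *
          (π θ s a * deriv (fun u => Real.log (π u s a)) θ) := by
      intro a
      have hpast : ∀ l < j, Function.update x j (s, a) l = Function.update x j (s, a₀) l :=
        fun l hl => by simp [Function.update_of_ne hl.ne]
      have he := entryProb_congr init trans j (Function.update x j (s, a))
        (Function.update x j (s, a₀)) hpast (by simp)
      have hh : h (path (Function.update x j (s, a))) =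
          h (path (Function.update x j (s, a₀))) := by
        refine hhist _ _ (fun l hl => ?_) (fun l hl => congrArg Prod.snd (hpast l hl))
        rcases hl.lt_or_eq with hl | rfl
        · exact congrArg Prod.fst (hpast l hl)
        · simp [path]
      simp only [g, if_true, he, hh]
      simp only [score, path, Function.update_self]
      ring
    simp only [hterm]
    rw [← Finset.mul_sum, sum_mul_deriv_log_eq_zero (fun u a => π u s a) (fun u => hπ_pos u s)
      (fun u => hπ_sum u s) (hπ_diff s), mul_zero]
  · intro i hi x
    obtain ⟨a₀⟩ := ‹Nonempty A›
    have hterm : ∀ s a, g i (Function.update x i (s, a)) =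
        entryProb init trans i (Function.update x i (s, a₀)) * π θ s a := by
      intro s a
      have he := entryProb_congr init trans i (Function.update x i (s, a))
        (Function.update x i (s, a₀))
        (fun l hl => by simp [Function.update_of_ne hl.ne]) (by simp)
      simp [g, hi.ne', he]
    rw [Fintype.sum_prod_type]
    simp only [hterm, ← Finset.mul_sum, hπ_sum, mul_one]
    exact sum_entryProb_update init trans htrans_sum i ((Fin.zero_le j).trans_lt hi) x a₀
  · intro i x y hxy
    have he := entryProb_congr init trans i x y (fun l hl => hxy l hl.le) (by rw [hxy i le_rfl])
    simp only [g, he, hxy i le_rfl]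
    split_ifs with hij
    · subst hij
      have hh : h (path x) = h (path y) :=
        hhist _ _ (fun l hl => congrArg Prod.fst (hxy l hl))
          (fun l hl => congrArg Prod.snd (hxy l hl.le))
      simp only [hh, score, path, hxy i le_rfl]
    · rfl
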